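/- Let n ≥ 2 and let M = (Fin n → ℤ) ⋊ Equiv.Perm (Fin n). The map φ : M → ℤ defined by φ(λ, π) = Σ_i λ(i) is a surjective group homomorphism, and its kernel is exactly the subgroup of M generated by the reflections {r_{ij}(k) = (k(e_i − e_j), swap i j) : i ≠ j, k ∈ ℤ}. Moreover, for n ≥ 3 this kernel is isomorphic to the Coxeter group of affine type Ã_{n−1}, i.e., to the Coxeter group of the Coxeter matrix on ℤ/n with m(i,j) = 3 when j = i ± 1 mod n and m(i,j) = 2 otherwise (m(i,i) = 1). -/

import Mathlib

open Multiplicative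

/-- The automorphism of `Multiplicative (Fin n → A)` permuting coordinates by `π`. -/
def permMulAut {n : ℕ} {A : Type*} [AddCommGroup A] (π : Equiv.Perm (Fin n)) :
    MulAut (Multiplicative (Fin n → A)) where
  toFun v := ofAdd fun i => toAdd v (π⁻¹ i)
  invFun v := ofAdd fun i => toAdd v (π i)
  left_inv v := by
    refine Multiplicative.toAdd.injective (funext fun i => ?_)
    simp
  right_inv v := by
    refine Multiplicative.toAdd.injective (funext fun i => ?_)
    simp
  map_mul' a b := rfl

/-- The coordinate-permutation action of `Equiv.Perm (Fin n)` on `Multiplicative (Fin n → A)`. -/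
def permAction (n : ℕ) (A : Type*) [AddCommGroup A] :
    Equiv.Perm (Fin n) →* MulAut (Multiplicative (Fin n → A)) where
  toFun := permMulAut
  map_one' := by
    refine MulEquiv.ext fun v => ?_
    refine Multiplicative.toAdd.injective (funext fun i => ?_)
    simp [permMulAut]
  map_mul' π σ := by
    refine MulEquiv.ext fun v => ?_
    refine Multiplicative.toAdd.injective (funext fun i => ?_)
    simp [permMulAut]

/-- The middle group `Mid(B_n) = (Fin n → ℤ) ⋊ Equiv.Perm (Fin n)`. -/
abbrev Mid (n : ℕ) := Multiplicative (Fin n → ℤ) ⋊[permAction n ℤ] Equiv.Perm (Fin n)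

/-- The reflections `r_{ij}(k) = (k(e_i − e_j), swap i j)` of the middle group. -/
def midRefl (n : ℕ) : Set (Mid n) :=
  {x | ∃ i j : Fin n, ∃ k : ℤ, i ≠ j ∧
        x = ⟨ofAdd (k • (Pi.single i (1 : ℤ) - Pi.single j (1 : ℤ))), Equiv.swap i j⟩}

/-- The vertical displacement map `(λ, π) ↦ Σ_i λ(i)`. -/
def vdisp (n : ℕ) (x : Mid n) : ℤ := ∑ i, toAdd x.left i

/-- The Coxeter matrix of affine type `Ã_{n−1}`, on the index set `ℤ/n`:
`m(i,j) = 3` when `j = i ± 1` and `m(i,j) = 2` otherwise (`m(i,i) = 1`). -/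
def affineACoxeterMatrix (n : ℕ) : CoxeterMatrix (ZMod n) where
  M := Matrix.of fun i j => if i = j then 1 else if j = i + 1 ∨ i = j + 1 then 3 else 2
  isSymm := by
    ext i j
    simp only [Matrix.transpose_apply, Matrix.of_apply]
    by_cases h : i = j
    · simp [h]
    · rw [if_neg (Ne.symm h), if_neg h]
      exact if_congr or_comm rfl rfl
  diagonal := by intro i; simp
  off_diagonal := by
    intro i j h
    simp only [Matrix.of_apply, if_neg h]
    split_ifs <;> omega

/-- A Coxeter-type injectivity criterion. Suppose a homomorphism `φ` from a Coxeter group with all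
`m(i,j) ≤ 3` has a notion of right descent on its range that is compatible with the dihedral
parabolic subgroups, strictly lowers an `ℕ`-valued potential and detects the identity.
Then `φ` is injective. -/
theorem CoxeterSystem.injective_of_descents {B W G : Type*} [Group W] [Group G]
    {M : CoxeterMatrix B} (cs : CoxeterSystem M W) (φ : W →* G)
    (hM : ∀ i j, i ≠ j → M i j = 2 ∨ M i j = 3)
    (desc : B → G → Prop) (μ : G → ℕ)
    (hμ : ∀ i x, desc i x → μ (x * φ (cs.simple i)) < μ x)
    (hflip : ∀ i x, desc i x ∨ desc i (x * φ (cs.simple i)))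
    (hone : ∀ i, ¬ desc i 1)
    (heq : ∀ x ∈ φ.range, (∀ i, ¬ desc i x) → x = 1)
    (hcomm : ∀ i j x, M i j = 2 → desc i x → desc j x → desc j (x * φ (cs.simple i)))
    (hbraid : ∀ i j x, M i j = 3 → desc i x → desc j x →
      desc j (x * φ (cs.simple i)) ∧ desc i (x * φ (cs.simple i) * φ (cs.simple j))) :
    Function.Injective φ := by
  let f : ℕ → G → Set W := fun k => Nat.rec (fun _ => ∅)
    (fun _ F x => {w | (x = 1 ∧ w = 1) ∨ ∃ i, desc i x ∧ ∃ u ∈ F (x * φ (cs.simple i)),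
      w = u * cs.simple i}) k
  let R : G → W → Prop := fun x w => ∃ k, w ∈ f k x
  have hR1 : R 1 1 := ⟨1, Or.inl ⟨rfl, rfl⟩⟩
  have hRs : ∀ x u i, desc i x → R (x * φ (cs.simple i)) u → R x (u * cs.simple i) :=
    fun x u i hd ⟨k, hk⟩ => ⟨k + 1, Or.inr ⟨i, hd, u, hk, rfl⟩⟩
  have hRcases : ∀ x w, R x w → (x = 1 ∧ w = 1) ∨ ∃ i, desc i x ∧
      ∃ u, R (x * φ (cs.simple i)) u ∧ w = u * cs.simple i := by
    rintro x w ⟨_ | k, hk⟩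
    · exact absurd hk (Set.notMem_empty _)
    · rcases hk with h | ⟨i, hd, u, hu, rfl⟩
      · exact Or.inl h
      · exact Or.inr ⟨i, hd, u, ⟨k, hu⟩, rfl⟩
  have hrange : ∀ x ∈ φ.range, ∀ i, x * φ (cs.simple i) ∈ φ.range :=
    fun x hx i => mul_mem hx ⟨_, rfl⟩
  have hex : ∀ N x, μ x = N → x ∈ φ.range → ∃ w, R x w := by
    intro N
    induction N using Nat.strong_induction_on with
    | _ N ih =>
      intro x hN hx
      by_cases h : ∀ i, ¬ desc i x
      · exact ⟨1, heq x hx h ▸ hR1⟩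
      · push Not at h
        obtain ⟨i, hi⟩ := h
        obtain ⟨u, hu⟩ := ih _ (hN ▸ hμ i x hi) _ rfl (hrange x hx i)
        exact ⟨_, hRs x u i hi hu⟩
  have huniq : ∀ N x, μ x = N → x ∈ φ.range → ∀ w w', R x w → R x w' → w = w' := by
    intro N
    induction N using Nat.strong_induction_on with
    | _ N ih =>
      intro x hN hx w w' hw hw'
      subst hN
      rcases hRcases x w hw with ⟨rfl, rfl⟩ | ⟨i, hi, u, hu, rfl⟩
      · rcases hRcases 1 w' hw' with ⟨-, rfl⟩ | ⟨i, hi, -⟩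
        · rfl
        · exact absurd hi (hone i)
      rcases hRcases x w' hw' with ⟨rfl, rfl⟩ | ⟨j, hj, u', hu', rfl⟩
      · exact absurd hi (hone i)
      have key : ∀ a v v', desc a x → R (x * φ (cs.simple a)) v →
          R (x * φ (cs.simple a)) v' → v = v' := fun a v v' ha =>
        ih _ (hμ a x ha) _ rfl (hrange x hx a) v v'
      by_cases hij : i = j
      · subst hij
        rw [key i u u' hi hu hu']
      have hrel := cs.simple_mul_simple_pow i j
      rcases hM i j hij with h2 | h3
      · have hs : cs.simple i * cs.simple j = cs.simple j * cs.simple i := by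
          rw [h2, pow_two] at hrel
          simpa [mul_inv_rev] using eq_inv_of_mul_eq_one_left hrel
        have hdj := hcomm i j x h2 hi hj
        have hdi := hcomm j i x (M.symmetric i j ▸ h2) hj hi
        have hc : x * φ (cs.simple i) * φ (cs.simple j) =
            x * φ (cs.simple j) * φ (cs.simple i) := by
          rw [mul_assoc, mul_assoc, ← map_mul, ← map_mul, hs]
        obtain ⟨v, hv⟩ := hex _ _ rfl (hrange _ (hrange x hx i) j)
        rw [key i u _ hi hu (hRs _ v j hdj hv), key j u' _ hj hu' (hRs _ v i hdi (hc ▸ hv)),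
          mul_assoc, mul_assoc, hs]
      · have hs : cs.simple i * cs.simple j * cs.simple i =
            cs.simple j * cs.simple i * cs.simple j := by
          rw [h3, pow_succ, pow_two] at hrel
          have : cs.simple i * cs.simple j * cs.simple i *
            (cs.simple j * (cs.simple i * cs.simple j)) = 1 := by simpa only [mul_assoc] using hrel
          simpa [mul_inv_rev, mul_assoc] using eq_inv_of_mul_eq_one_left this
        obtain ⟨hdj, hdi⟩ := hbraid i j x h3 hi hj
        obtain ⟨hdi', hdj'⟩ := hbraid j i x (M.symmetric i j ▸ h3) hj hi
        have hc : x * φ (cs.simple i) * φ (cs.simple j) * φ (cs.simple i) =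
            x * φ (cs.simple j) * φ (cs.simple i) * φ (cs.simple j) := by
          simp only [mul_assoc, ← map_mul]
          simp only [← mul_assoc, hs]
        obtain ⟨v, hv⟩ := hex _ _ rfl (hrange _ (hrange _ (hrange x hx i) j) i)
        rw [key i u _ hi hu (hRs _ _ j hdj (hRs _ v i hdi hv)),
          key j u' _ hj hu' (hRs _ _ i hdi' (hRs _ v j hdj' (hc ▸ hv)))]
        simp only [mul_assoc] at hs ⊢
        rw [hs]
  have hstep : ∀ x ∈ φ.range, ∀ w i, R x w → R (x * φ (cs.simple i)) (w * cs.simple i) := by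
    intro x hx w i hw
    rcases hflip i x with hd | hd
    · obtain ⟨v, hv⟩ := hex _ _ rfl (hrange x hx i)
      rw [huniq _ _ rfl hx _ _ hw (hRs x v i hd hv)]
      simpa using hv
    · refine hRs _ _ i hd ?_
      rwa [mul_assoc, ← map_mul, cs.simple_mul_simple_self, map_one, mul_one]
  have hRφ : ∀ w, R (φ w) w := by
    intro w
    induction w using cs.simple_induction_right with
    | one => simpa using hR1
    | mul_simple_right w i ih =>
      rw [map_mul]
      exact hstep _ ⟨w, rfl⟩ _ _ ih
  intro w w' h
  exact huniq _ _ rfl ⟨w, rfl⟩ _ _ (hRφ w) (h ▸ hRφ w')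

/-- The vertical displacement map is additive. -/
theorem vdisp_mul {n : ℕ} (x y : Mid n) : vdisp n (x * y) = vdisp n x + vdisp n y := by
  have h : ∑ i, toAdd y.left (x.right⁻¹ i) = ∑ i, toAdd y.left i :=
    Equiv.sum_comp x.right⁻¹ (fun i => toAdd y.left i)
  simp only [vdisp, ← h, ← Finset.sum_add_distrib]
  rfl

theorem vdisp_one {n : ℕ} : vdisp n 1 = 0 := by simp [vdisp]

theorem vdisp_inv {n : ℕ} (x : Mid n) : vdisp n x⁻¹ = -vdisp n x := by
  have h := vdisp_mul x x⁻¹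
  rw [mul_inv_cancel, vdisp_one] at h
  omega

theorem vdisp_surjective {n : ℕ} (hn : 0 < n) : Function.Surjective (vdisp n) := fun k =>
  ⟨⟨ofAdd (Pi.single ⟨0, hn⟩ k), 1⟩, by simp [vdisp]⟩

theorem vdisp_eq_zero_of_mem_closure {n : ℕ} {x : Mid n}
    (hx : x ∈ Subgroup.closure (midRefl n)) : vdisp n x = 0 := by
  induction hx using Subgroup.closure_induction with
  | mem x hx =>
    obtain ⟨i, j, k, -, rfl⟩ := hx
    simp [vdisp, ← Finset.mul_sum]
  | one => exact vdisp_one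
  | mul x y _ _ hx hy => rw [vdisp_mul, hx, hy, add_zero]
  | inv x _ hx => rw [vdisp_inv, hx, neg_zero]

/-- Viewing `(λ, π)` as the affine permutation `j ↦ π j + n λ(π j)` of `ℤ`, the displacement of
the point `j` of the fundamental window. -/
def displacement {n : ℕ} (x : Mid n) (j : Fin n) : ℤ :=
  x.right j + n * toAdd x.left (x.right j) - j

theorem displacement_one {n : ℕ} (j : Fin n) : displacement (1 : Mid n) j = 0 := by
  simp [displacement]

theorem Fin.eq_and_eq_of_add_mul_eq {n : ℕ} {a b : Fin n} {k l : ℤ}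
    (h : (a : ℤ) + n * k = b + n * l) : a = b ∧ k = l := by
  have hn : (n : ℤ) ≠ 0 := by have := a.2; omega
  have hab : a = b := by
    have h' := congrArg (· % (n : ℤ)) h
    simp only [Int.add_mul_emod_self_left] at h'
    rw [Int.emod_eq_of_lt (by omega) (by omega), Int.emod_eq_of_lt (by omega) (by omega)] at h'
    exact Fin.ext (by omega)
  subst hab
  exact ⟨rfl, mul_left_cancel₀ hn (by linarith)⟩

theorem displacement_injective {n : ℕ} :
    Function.Injective (displacement : Mid n → Fin n → ℤ) := by
  intro x y h
  have hj : ∀ j, x.right j = y.right j ∧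
      toAdd x.left (x.right j) = toAdd y.left (y.right j) := fun j => by
    have := congrFun h j
    simp only [displacement] at this
    exact Fin.eq_and_eq_of_add_mul_eq (by linarith)
  refine SemidirectProduct.ext (Multiplicative.toAdd.injective (funext fun i => ?_))
    (Equiv.ext fun j => (hj j).1)
  obtain ⟨j, rfl⟩ := x.right.surjective i
  rw [(hj j).2, (hj j).1]

theorem sum_displacement {n : ℕ} (x : Mid n) : ∑ j, displacement x j = n * vdisp n x := by
  have h₁ : ∑ j, ((x.right j : Fin n) : ℤ) = ∑ j : Fin n, (j : ℤ) :=
    Equiv.sum_comp x.right (fun j : Fin n => (j : ℤ))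
  have h₂ : ∑ j, toAdd x.left (x.right j) = ∑ j, toAdd x.left j :=
    Equiv.sum_comp x.right (fun j => toAdd x.left j)
  simp only [displacement, Finset.sum_sub_distrib, Finset.sum_add_distrib, ← Finset.mul_sum, h₁, h₂,
    vdisp]
  ring

/-- The simple reflections of the euclidean symmetric group, exchanging neighbouring integers. -/
def midSimple {n : ℕ} (i : Fin (n + 2)) : Mid (n + 2) :=
  ⟨ofAdd ((if i = Fin.last (n + 1) then -1 else 0 : ℤ) •
    (Pi.single i (1 : ℤ) - Pi.single (i + 1) (1 : ℤ))), Equiv.swap i (i + 1)⟩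

theorem Fin.self_ne_add_one {n : ℕ} (i : Fin (n + 2)) : i ≠ i + 1 := by simp

theorem midSimple_mem_midRefl {n : ℕ} (i : Fin (n + 2)) : midSimple i ∈ midRefl (n + 2) :=
  ⟨i, i + 1, _, i.self_ne_add_one, rfl⟩

theorem displacement_mul_midSimple {n : ℕ} (x : Mid (n + 2)) (i j : Fin (n + 2)) :
    displacement (x * midSimple i) j =
      if j = i then displacement x (i + 1) + 1
      else if j = i + 1 then displacement x i - 1 else displacement x j := by
  have hmul : ∀ y : Mid (n + 2), displacement (x * y) j = displacement x (y.right j) +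
      (y.right j : ℕ) + (n + 2 : ℕ) * toAdd y.left (y.right j) - j := fun y => by
    have h : toAdd (x * y).left ((x * y).right j) =
        toAdd x.left (x.right (y.right j)) +
          toAdd y.left (x.right⁻¹ (x.right (y.right j))) := rfl
    rw [← Equiv.Perm.mul_apply x.right⁻¹, inv_mul_cancel, Equiv.Perm.one_apply] at h
    rw [displacement, h, displacement, SemidirectProduct.mul_right, Equiv.Perm.mul_apply]
    ring
  have hne := i.self_ne_add_one
  have hval := Fin.val_add_one i
  rw [hmul]
  simp only [midSimple]
  rcases eq_or_ne j i with h₁ | h₁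
  · subst h₁
    rw [Equiv.swap_apply_left, if_pos rfl]
    simp only [toAdd_ofAdd, Pi.smul_apply, Pi.sub_apply, Pi.single_eq_same,
      Pi.single_eq_of_ne hne.symm]
    split_ifs at hval ⊢ with hl
    · have := congrArg Fin.val hl
      simp only [Fin.val_last] at this
      simp only [hval, this, smul_eq_mul]
      push_cast
      ring
    · simp only [hval, smul_eq_mul]
      push_cast
      ring
  rcases eq_or_ne j (i + 1) with h₂ | h₂
  · subst h₂
    rw [Equiv.swap_apply_right, if_neg hne.symm, if_pos rfl]
    simp only [toAdd_ofAdd, Pi.smul_apply, Pi.sub_apply, Pi.single_eq_same,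
      Pi.single_eq_of_ne hne]
    split_ifs at hval ⊢ with hl
    · have := congrArg Fin.val hl
      simp only [Fin.val_last] at this
      simp only [hval, this, smul_eq_mul]
      push_cast
      ring
    · simp only [hval, smul_eq_mul]
      push_cast
      ring
  · rw [Equiv.swap_apply_of_ne_of_ne h₁ h₂, if_neg h₁, if_neg h₂]
    simp only [toAdd_ofAdd, Pi.smul_apply, Pi.sub_apply, Pi.single_eq_of_ne h₁,
      Pi.single_eq_of_ne h₂, sub_zero, smul_zero, mul_zero, add_zero, add_sub_cancel_right]

theorem displacement_midSimple {n : ℕ} (i j : Fin (n + 2)) :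
    displacement (midSimple i) j = if j = i then 1 else if j = i + 1 then -1 else 0 := by
  simpa [displacement_one] using displacement_mul_midSimple 1 i j

theorem displacement_ne_add_one {n : ℕ} (x : Mid (n + 2)) (i : Fin (n + 2)) :
    displacement x i ≠ displacement x (i + 1) + 1 := by
  intro h
  have h' := displacement_mul_midSimple x i i
  rw [if_pos rfl, ← h] at h'
  simp only [displacement, sub_left_inj] at h'
  have := (Fin.eq_and_eq_of_add_mul_eq h').1
  simp [midSimple] at this

/-- `i` is a right descent of `x`: as an affine permutation, `x` reverses the order of `i` and
`i + 1`. -/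
def IsMidDescent {n : ℕ} (i : Fin (n + 2)) (x : Mid (n + 2)) : Prop :=
  displacement x (i + 1) + 1 < displacement x i

/-- The squared displacement of an element of the middle group. -/
def energy {n : ℕ} (x : Mid n) : ℕ := ∑ j, (displacement x j).natAbs ^ 2

theorem energy_mul_midSimple_lt {n : ℕ} {x : Mid (n + 2)} {i : Fin (n + 2)}
    (h : IsMidDescent i x) : energy (x * midSimple i) < energy x := by
  have hne := i.self_ne_add_one
  have hmem : i + 1 ∈ Finset.univ.erase i := by simp
  have hsplit : ∀ y : Mid (n + 2), (energy y : ℤ) = displacement y i ^ 2 +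
      (displacement y (i + 1) ^ 2 +
        ∑ j ∈ (Finset.univ.erase i).erase (i + 1), displacement y j ^ 2) := fun y => by
    rw [Finset.add_sum_erase _ (fun j => displacement y j ^ 2) hmem,
      Finset.add_sum_erase _ (fun j => displacement y j ^ 2) (Finset.mem_univ i)]
    simp [energy]
  have hrest : ∑ j ∈ (Finset.univ.erase i).erase (i + 1), displacement (x * midSimple i) j ^ 2 =
      ∑ j ∈ (Finset.univ.erase i).erase (i + 1), displacement x j ^ 2 :=
    Finset.sum_congr rfl fun j hj => by
      simp only [Finset.mem_erase] at hj
      rw [displacement_mul_midSimple, if_neg hj.2.1, if_neg hj.1]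
  zify
  rw [hsplit, hsplit, hrest, displacement_mul_midSimple, displacement_mul_midSimple,
    if_pos rfl, if_neg hne.symm, if_pos rfl]
  unfold IsMidDescent at h
  nlinarith

theorem isMidDescent_or_mul {n : ℕ} (i : Fin (n + 2)) (x : Mid (n + 2)) :
    IsMidDescent i x ∨ IsMidDescent i (x * midSimple i) := by
  have h := displacement_ne_add_one x i
  simp only [IsMidDescent, displacement_mul_midSimple, if_true, if_neg i.self_ne_add_one.symm]
  omega

theorem not_isMidDescent_one {n : ℕ} (i : Fin (n + 2)) : ¬ IsMidDescent i 1 := by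
  simp [IsMidDescent, displacement_one]

theorem eq_one_of_forall_not_isMidDescent {n : ℕ} {x : Mid (n + 2)} (hx : vdisp _ x = 0)
    (h : ∀ i, ¬ IsMidDescent i x) : x = 1 := by
  have hle : ∀ i, 0 ≤ displacement x (i + 1) - displacement x i := fun i => by
    have h₁ := h i
    have h₂ := displacement_ne_add_one x i
    unfold IsMidDescent at h₁
    omega
  have hsum : ∑ i, (displacement x (i + 1) - displacement x i) = 0 := by
    rw [Finset.sum_sub_distrib, sub_eq_zero]
    exact Equiv.sum_comp (Equiv.addRight 1) (displacement x)
  have hstep : ∀ i, displacement x (i + 1) = displacement x i := fun i =>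
    sub_eq_zero.1 ((Finset.sum_eq_zero_iff_of_nonneg fun i _ => hle i).1 hsum i (Finset.mem_univ i))
  have hconst : ∀ i, displacement x i = displacement x 0 := fun i => by
    induction i using Fin.induction with
    | zero => rfl
    | succ i ih => rw [← Fin.coeSucc_eq_succ, hstep, ih]
  have htot := sum_displacement x
  rw [hx, mul_zero, Finset.sum_congr rfl fun i _ => hconst i, Finset.sum_const, Finset.card_univ,
    Fintype.card_fin, smul_eq_zero] at htot
  refine displacement_injective (funext fun i => ?_)
  rw [hconst, displacement_one, htot.resolve_left (by omega)]

theorem mem_closure_midSimple {n : ℕ} {x : Mid (n + 2)} (hx : vdisp _ x = 0) :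
    x ∈ Subgroup.closure (Set.range (midSimple (n := n))) := by
  induction hN : energy x using Nat.strong_induction_on generalizing x with
  | _ N ih =>
    by_cases h : ∀ i, ¬ IsMidDescent i x
    · rw [eq_one_of_forall_not_isMidDescent hx h]
      exact one_mem _
    · push Not at h
      obtain ⟨i, hi⟩ := h
      have hs : vdisp _ (midSimple i) = 0 :=
        vdisp_eq_zero_of_mem_closure (Subgroup.subset_closure (midSimple_mem_midRefl i))
      have hmem := ih _ (hN ▸ energy_mul_midSimple_lt hi) (by rw [vdisp_mul, hx, hs, add_zero]) rfl
      exact (Subgroup.mul_mem_cancel_right _ (Subgroup.subset_closure (Set.mem_range_self i))).1 hmem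

theorem closure_range_midSimple (n : ℕ) :
    Subgroup.closure (Set.range (midSimple (n := n))) = Subgroup.closure (midRefl (n + 2)) :=
  le_antisymm (Subgroup.closure_mono (Set.range_subset_iff.2 midSimple_mem_midRefl))
    fun _ hx => mem_closure_midSimple (vdisp_eq_zero_of_mem_closure hx)

theorem midSimple_mul_self {n : ℕ} (i : Fin (n + 2)) : midSimple i * midSimple i = 1 := by
  refine displacement_injective (funext fun j => ?_)
  simp only [displacement_mul_midSimple, displacement_midSimple, displacement_one]
  have := i.self_ne_add_one
  grind

theorem midSimple_mul_comm {n : ℕ} {i j : Fin (n + 2)} (hij : i ≠ j) (h₁ : j ≠ i + 1)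
    (h₂ : i ≠ j + 1) : midSimple i * midSimple j = midSimple j * midSimple i := by
  refine displacement_injective (funext fun k => ?_)
  simp only [displacement_mul_midSimple, displacement_midSimple]
  have := i.self_ne_add_one
  have := j.self_ne_add_one
  have : i + 1 ≠ j + 1 := fun h => hij (add_right_cancel h)
  grind

theorem Fin.add_one_add_one_ne {n : ℕ} (hn : 1 ≤ n) (i : Fin (n + 2)) : i + 1 + 1 ≠ i := by
  rw [add_assoc, Ne, add_eq_left, Fin.ext_iff, Fin.val_add, Fin.val_one, Fin.val_zero,
    Nat.mod_eq_of_lt (by omega)]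
  omega

theorem midSimple_braid {n : ℕ} (hn : 1 ≤ n) (i : Fin (n + 2)) :
    midSimple i * midSimple (i + 1) * midSimple i =
      midSimple (i + 1) * midSimple i * midSimple (i + 1) := by
  refine displacement_injective (funext fun k => ?_)
  simp only [displacement_mul_midSimple, displacement_midSimple]
  have := i.self_ne_add_one
  have := (i + 1).self_ne_add_one
  have := Fin.add_one_add_one_ne hn i
  grind

theorem affineACoxeterMatrix_apply (n : ℕ) (i j : Fin (n + 2)) :
    affineACoxeterMatrix (n + 2) i j =
      if i = j then 1 else if j = i + 1 ∨ i = j + 1 then 3 else 2 := by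
  simp only [affineACoxeterMatrix]
  rfl

theorem isLiftable_midSimple {n : ℕ} (hn : 1 ≤ n) :
    (affineACoxeterMatrix (n + 2)).IsLiftable (midSimple (n := n)) := by
  have hbraid : ∀ i : Fin (n + 2), (midSimple i * midSimple (i + 1)) ^ 3 = 1 := fun i => by
    calc (midSimple i * midSimple (i + 1)) ^ 3
        = (midSimple i * midSimple (i + 1) * midSimple i) *
          (midSimple (i + 1) * midSimple i * midSimple (i + 1)) := by
            simp only [pow_succ, pow_zero, one_mul, mul_assoc]
      _ = midSimple i * (midSimple (i + 1) * (midSimple i * midSimple i) * midSimple (i + 1)) *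
          midSimple i := by rw [← midSimple_braid hn]; simp only [mul_assoc]
      _ = 1 := by simp only [midSimple_mul_self, mul_one]
  intro (i : Fin (n + 2)) (j : Fin (n + 2))
  rw [affineACoxeterMatrix_apply]
  split_ifs with h₁ h₂
  · rw [h₁, midSimple_mul_self, one_pow]
  · rcases h₂ with rfl | rfl
    · exact hbraid i
    · rw [← inv_inj, ← inv_pow, mul_inv_rev, inv_one,
        ← eq_inv_of_mul_eq_one_left (midSimple_mul_self _),
        ← eq_inv_of_mul_eq_one_left (midSimple_mul_self _)]
      exact hbraid j
  · push Not at h₂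
    rw [pow_two]
    nth_rw 1 [midSimple_mul_comm h₁ h₂.1 h₂.2]
    rw [mul_assoc, ← mul_assoc (midSimple i), midSimple_mul_self, one_mul, midSimple_mul_self]

/-- The homomorphism from the affine Coxeter group to the middle group sending the simple
generators to the simple reflections. -/
noncomputable def affineToMid {n : ℕ} (hn : 1 ≤ n) :
    (affineACoxeterMatrix (n + 2)).Group →* Mid (n + 2) :=
  (affineACoxeterMatrix (n + 2)).toCoxeterSystem.lift ⟨midSimple, isLiftable_midSimple hn⟩

theorem affineToMid_simple {n : ℕ} (hn : 1 ≤ n) (i : Fin (n + 2)) :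
    affineToMid hn ((affineACoxeterMatrix (n + 2)).toCoxeterSystem.simple i) = midSimple i :=
  CoxeterSystem.lift_apply_simple _ (isLiftable_midSimple hn) i

theorem range_affineToMid {n : ℕ} (hn : 1 ≤ n) :
    (affineToMid hn).range = Subgroup.closure (midRefl (n + 2)) := by
  rw [MonoidHom.range_eq_map,
    ← (affineACoxeterMatrix (n + 2)).toCoxeterSystem.subgroup_closure_range_simple,
    MonoidHom.map_closure, ← closure_range_midSimple, ← Set.range_comp]
  congr 2
  exact funext fun i => affineToMid_simple hn i

theorem affineToMid_injective {n : ℕ} (hn : 1 ≤ n) : Function.Injective (affineToMid hn) := by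
  refine CoxeterSystem.injective_of_descents (affineACoxeterMatrix (n + 2)).toCoxeterSystem
    (affineToMid hn) ?_ (fun i x => IsMidDescent (n := n) i x) energy ?_ ?_
    not_isMidDescent_one ?_ ?_ ?_
  · intro (i : Fin (n + 2)) (j : Fin (n + 2)) hij
    rw [affineACoxeterMatrix_apply, if_neg (show ¬ (i : Fin (n + 2)) = j from hij)]
    split_ifs <;> simp
  · intro (i : Fin (n + 2)) x h
    rw [affineToMid_simple]
    exact energy_mul_midSimple_lt h
  · intro (i : Fin (n + 2)) x
    rw [affineToMid_simple]
    exact isMidDescent_or_mul i x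
  · intro x hx h
    rw [range_affineToMid] at hx
    exact eq_one_of_forall_not_isMidDescent (vdisp_eq_zero_of_mem_closure hx) h
  · intro (i : Fin (n + 2)) (j : Fin (n + 2)) x hM hi hj
    rw [affineACoxeterMatrix_apply] at hM
    split_ifs at hM with h₁ h₂
    · omega
    · omega
    push Not at h₂
    rw [affineToMid_simple]
    simp only [IsMidDescent, displacement_mul_midSimple] at hi hj ⊢
    have : i + 1 ≠ j + 1 := fun h => h₁ (add_right_cancel h)
    grind
  · intro (i : Fin (n + 2)) (j : Fin (n + 2)) x hM hi hj
    rw [affineACoxeterMatrix_apply] at hM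
    split_ifs at hM with h₁ h₂
    · omega
    swap
    · omega
    rw [affineToMid_simple, affineToMid_simple]
    simp only [IsMidDescent, displacement_mul_midSimple] at hi hj ⊢
    have := i.self_ne_add_one
    have := j.self_ne_add_one
    have := Fin.add_one_add_one_ne hn i
    have := Fin.add_one_add_one_ne hn j
    have : i + 1 ≠ j + 1 := fun h => h₁ (add_right_cancel h)
    rcases h₂ with rfl | rfl <;> grind

/-- For `n ≥ 2`, the vertical displacement map `φ(λ, π) = Σ_i λ(i)` on the middle group
`Mid(B_n)` is a surjective group homomorphism (written additively), its kernel is exactly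
the subgroup generated by the reflections `r_{ij}(k)`, and for `n ≥ 3` this kernel is
isomorphic to the Coxeter group of affine type `Ã_{n−1}`. -/
theorem vertical_displacement_map (n : ℕ) (hn : 2 ≤ n) :
    (∀ x y : Mid n, vdisp n (x * y) = vdisp n x + vdisp n y) ∧
    Function.Surjective (vdisp n) ∧
    {x : Mid n | vdisp n x = 0} = (Subgroup.closure (midRefl n) : Set (Mid n)) ∧
    (3 ≤ n →
      Nonempty (↥(Subgroup.closure (midRefl n)) ≃* (affineACoxeterMatrix n).Group)) := by
  obtain ⟨m, rfl⟩ := Nat.exists_eq_add_of_le' hn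
  refine ⟨vdisp_mul, vdisp_surjective (by omega), ?_, fun h => ?_⟩
  · ext x
    refine ⟨fun hx => ?_, vdisp_eq_zero_of_mem_closure⟩
    rw [← closure_range_midSimple]
    exact mem_closure_midSimple hx
  · have hm : 1 ≤ m := by omega
    exact ⟨((MonoidHom.ofInjective (affineToMid_injective hm)).trans
      (MulEquiv.subgroupCongr (range_affineToMid hm))).symm⟩
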